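/- Let D be a digraph of order n ≥ k + 1, where k ≥ 2 is an integer. If δ⁰(D) ≥ ⌈(n + k − 1)/2⌉, then D is one-to-one k-coverable. -/

import Mathlib

/-- A directed path in the digraph with arc relation `A`: a nonempty list of
pairwise distinct vertices, with consecutive vertices joined by arcs,
starting at `s` and ending at `t`. -/
def IsDipath {V : Type*} (A : V → V → Prop) (p : List V) (s t : V) : Prop :=
  p ≠ [] ∧ p.Chain' A ∧ p.Nodup ∧ p.head? = some s ∧ p.getLast? = some t

/-- The out-degree of a vertex `v` in the digraph with arc relation `A`. -/
noncomputable def outDeg {V : Type*} (A : V → V → Prop) (v : V) : ℕ :=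
  Nat.card {w : V // A v w}

/-- The in-degree of a vertex `v` in the digraph with arc relation `A`. -/
noncomputable def inDeg {V : Type*} (A : V → V → Prop) (v : V) : ℕ :=
  Nat.card {w : V // A w v}

/-- The digraph with arc relation `A` is one-to-one `k`-coverable: for every
pair of distinct vertices `s` and `t` there are `k` directed paths from `s`
to `t` covering all vertices, any two of them meeting exactly in `{s, t}`. -/
def OneToOneCoverable {V : Type*} (A : V → V → Prop) (k : ℕ) : Prop :=
  ∀ s t : V, s ≠ t →
    ∃ P : Fin k → List V,
      (∀ i, IsDipath A (P i) s t) ∧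
      (∀ i j, i ≠ j → ∀ v, v ∈ P i → v ∈ P j → v = s ∨ v = t) ∧
      (∀ v : V, ∃ i, v ∈ P i)

section

open List

/-- The cyclic list `C` splits as a segment `Q` followed by a segment `R`
starting in `T` and ending in `S`. -/
def CyclicSplit {α : Type*} (S T : α → Bool) (C Q R : List α) : Prop :=
  (Q ++ R) ~r C ∧ (∃ a ∈ R.getLast?, S a) ∧ (∃ b ∈ R.head?, T b)

theorem countP_add_countP_le_of_isChain {α : Type*} (S T : α → Bool) (R : List α) (x : α)
    (h : (x :: R).IsChain fun x y => ¬(S x ∧ T y)) :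
    (x :: R).countP S + (x :: R).countP T + 1 ≤
      (x :: R).length + (T x).toNat + (S ((x :: R).getLast (cons_ne_nil x R))).toNat := by
  induction R generalizing x with
  | nil => cases hS : S x <;> cases hT : T x <;> simp [hS, hT]
  | cons y R ih =>
    rw [isChain_cons_cons] at h
    have := ih y h.2
    rw [countP_cons (a := x), countP_cons (a := x), getLast_cons (cons_ne_nil y R), length_cons]
    have h1 := h.1
    cases hS : S x <;> cases hT : T x <;> cases hT' : T y <;> simp_all <;> omega

theorem exists_cyclicSplit {α : Type*} {S T : α → Bool} {C : List α} {a b : α}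
    (ha : a ∈ C) (hSa : S a) (hb : b ∈ C) (hTb : T b) : ∃ Q R, CyclicSplit S T C Q R := by
  obtain ⟨C₁, C₂, rfl⟩ := append_of_mem ha
  have hb' : b ∈ C₂ ++ C₁ ++ [a] := by simp at hb ⊢; tauto
  obtain ⟨Q, R, h⟩ := append_of_mem hb'
  have hr : (Q ++ b :: R) ~r (C₁ ++ a :: C₂) := by
    rw [← h]
    have := (isRotated_append (l := C₁ ++ [a]) (l' := C₂)).symm
    simpa using this
  refine ⟨Q, b :: R, hr, ⟨a, ?_, hSa⟩, ⟨b, by simp, hTb⟩⟩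
  have := congrArg getLast? h
  rw [getLast?_append_of_ne_nil _ (cons_ne_nil b R)] at this
  simp [← this]

theorem CyclicSplit.countP_add_countP_le {α : Type*} {S T : α → Bool} {C : List α} {p : ℕ}
    (hp : 1 ≤ p) (hgap : ∀ Q R, CyclicSplit S T C Q R → p ≤ Q.length)
    (hex : ∃ Q R, CyclicSplit S T C Q R) :
    C.countP S + C.countP T + p ≤ C.length + 1 ∧
    (C.countP S + C.countP T + p = C.length + 1 → ∀ w ∈ C, ¬ S w → ¬ T w →
      ∃ Q R, CyclicSplit S T C Q R ∧ w ∈ Q ∧ Q.length = p) := by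
  classical
  have hex' : ∃ n, ∃ Q R, CyclicSplit S T C Q R ∧ Q.length = n := by
    obtain ⟨Q, R, h⟩ := hex
    exact ⟨_, Q, R, h, rfl⟩
  obtain ⟨Q, R, hQR, hlen⟩ := Nat.find_spec hex'
  have hmin : ∀ Q' R', CyclicSplit S T C Q' R' → Q.length ≤ Q'.length := by
    intro Q' R' h
    rw [hlen]
    exact Nat.find_min' hex' ⟨Q', R', h, rfl⟩
  clear hlen hex hex'
  have hpQ := hgap Q R hQR
  obtain ⟨hrot, ⟨a, ha, hSa⟩, ⟨b, hb, hTb⟩⟩ := hQR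
  have hQS : Q.countP S = 0 := by
    rw [countP_eq_zero]
    intro x hx hSx
    obtain ⟨Q₁, Q₂, rfl⟩ := append_of_mem hx
    have := hmin Q₂ (R ++ Q₁ ++ [x]) ⟨?_, ⟨x, by simp, hSx⟩, ⟨b, by simp_all, hTb⟩⟩
    · simp at this; omega
    · refine IsRotated.trans ?_ hrot
      have := isRotated_append (l := Q₂ ++ R) (l' := Q₁ ++ [x])
      simpa using this
  have hQT : Q.countP T = 0 := by
    rw [countP_eq_zero]
    intro x hx hTx
    obtain ⟨Q₁, Q₂, rfl⟩ := append_of_mem hx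
    have := hmin Q₁ (x :: Q₂ ++ R) ⟨by simpa using hrot, ⟨a, ?_, hSa⟩, ⟨x, by simp, hTx⟩⟩
    · simp at this
    · rw [getLast?_append]; simp_all
  have hchain : R.IsChain fun x y => ¬(S x ∧ T y) := by
    rw [isChain_iff_forall_rel_of_append_cons_cons]
    rintro x y R₁ R₂ rfl ⟨hSx, hTy⟩
    have := hgap [] (y :: R₂ ++ Q ++ R₁ ++ [x]) ⟨?_, ⟨x, getLast?_concat, hSx⟩, ⟨y, by simp, hTy⟩⟩
    · simp at this; omega
    · refine IsRotated.trans ?_ hrot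
      have := isRotated_append (l := y :: R₂) (l' := Q ++ R₁ ++ [x])
      simpa using this
  have hS : C.countP S = R.countP S := by
    rw [← hrot.perm.countP_eq, countP_append, hQS, zero_add]
  have hT : C.countP T = R.countP T := by
    rw [← hrot.perm.countP_eq, countP_append, hQT, zero_add]
  have hl : C.length = Q.length + R.length := by
    rw [← hrot.perm.length_eq, length_append]
  obtain ⟨R', rfl⟩ : ∃ R', R = b :: R' := by
    cases R with
    | nil => simp at hb
    | cons c R' => exact ⟨R', by simp_all⟩
  have hlast : (b :: R').getLast (cons_ne_nil b R') = a := by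
    rw [getLast?_eq_getLast_of_ne_nil (cons_ne_nil b R')] at ha
    simpa using ha
  have hbd := countP_add_countP_le_of_isChain S T R' b hchain
  rw [hlast, hSa, hTb] at hbd
  simp only [Bool.toNat_true] at hbd
  refine ⟨by omega, fun heq w hw hSw hTw => ?_⟩
  rw [← hrot.perm.mem_iff, mem_append] at hw
  rcases hw with hw | hw
  · exact ⟨Q, _, ⟨hrot, ⟨a, ha, hSa⟩, ⟨b, hb, hTb⟩⟩, hw, by omega⟩
  obtain ⟨R₁, R₂, hR⟩ := append_of_mem hw
  rw [hR] at hchain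
  rcases eq_nil_or_concat R₁ with rfl | ⟨L, y, rfl⟩
  · simp at hR; simp_all
  rcases R₂ with _ | ⟨z, L'⟩
  · have : a = w := by rw [← hlast]; simp [hR]
    simp_all
  have h1 : (L ++ [y]).countP S + (L ++ [y]).countP T ≤ (L ++ [y]).length + (S y).toNat := by
    rcases hL : L ++ [y] with _ | ⟨c, M⟩
    · simp at hL
    have hc : (c :: M).IsChain fun x y => ¬(S x ∧ T y) := by
      rw [← hL]
      simp only [concat_eq_append] at hchain
      exact hchain.left_of_append
    have := countP_add_countP_le_of_isChain S T M c hc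
    have hy : (c :: M).getLast (cons_ne_nil c M) = y := by simp [← hL]
    rw [hy] at this
    have := Bool.toNat_le (T c)
    omega
  have h2 : (z :: L').countP S + (z :: L').countP T ≤ (z :: L').length + (T z).toNat := by
    have hc : (z :: L').IsChain fun x y => ¬(S x ∧ T y) := hchain.right_of_append.tail
    have := countP_add_countP_le_of_isChain S T L' z hc
    have := Bool.toNat_le (S ((z :: L').getLast (cons_ne_nil z L')))
    omega
  have hcS : (b :: R').countP S = (L ++ [y]).countP S + (z :: L').countP S := by
    rw [hR, countP_append, countP_cons (a := w)]; simp [hSw]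
  have hcT : (b :: R').countP T = (L ++ [y]).countP T + (z :: L').countP T := by
    rw [hR, countP_append, countP_cons (a := w)]; simp [hTw]
  have hcl : (b :: R').length = (L ++ [y]).length + (z :: L').length + 1 := by
    rw [hR]; simp; omega
  have hSy : S y := by
    by_contra h
    have := Bool.toNat_le (T z)
    simp only [Bool.not_eq_true] at h
    simp only [h, Bool.toNat_false] at h1
    omega
  have hTz : T z := by
    by_contra h
    have := Bool.toNat_le (S y)
    simp only [Bool.not_eq_true] at h
    simp only [h, Bool.toNat_false] at h2
    omega
  have hsplit : CyclicSplit S T C [w] (z :: L' ++ Q ++ L ++ [y]) := by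
    refine ⟨?_, ⟨y, getLast?_concat, hSy⟩, ⟨z, by simp, hTz⟩⟩
    refine IsRotated.trans ?_ hrot
    rw [hR]
    have := isRotated_append (l := w :: z :: L') (l' := Q ++ L ++ [y])
    simpa using this
  have := hgap _ _ hsplit
  exact ⟨_, _, hsplit, by simp, by simp at this ⊢; omega⟩

/-- A directed cycle, as the list of its vertices (a single vertex with a loop is allowed). -/
def IsDicycle {V : Type*} (A : V → V → Prop) (C : List V) : Prop :=
  C ≠ [] ∧ C.Nodup ∧ (C ++ C).IsChain A

theorem isDicycle_iff {V : Type*} {A : V → V → Prop} {C : List V} :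
    IsDicycle A C ↔ C ≠ [] ∧ C.Nodup ∧ C.IsChain A ∧
      ∀ x ∈ C.getLast?, ∀ y ∈ C.head?, A x y := by
  simp only [IsDicycle, isChain_append]
  tauto

theorem IsDicycle.isRotated {V : Type*} {A : V → V → Prop} {C C' : List V}
    (h : IsDicycle A C) (hr : C ~r C') : IsDicycle A C' := by
  obtain ⟨n, rfl⟩ := hr
  rw [isDicycle_iff]
  obtain ⟨h0, hnd, hch⟩ := h
  refine ⟨by simpa using h0, by simpa using hnd, ?_⟩
  induction n with
  | zero =>
    rw [rotate_zero]
    rw [isChain_append] at hch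
    tauto
  | succ n ih =>
    rw [← rotate_rotate]
    rcases hC : C.rotate n with _ | ⟨x, L⟩
    · simp_all
    rw [hC] at ih
    obtain ⟨h1, h2⟩ := ih
    simp only [rotate_cons_succ, rotate_zero]
    rw [isChain_append]
    rcases L with _ | ⟨y, L⟩
    · simpa using h2
    · rw [isChain_cons_cons] at h1
      refine ⟨⟨h1.2, by simp, ?_⟩, ?_⟩
      · intro a ha b hb
        refine h2 a ?_ b (by simpa using hb)
        rw [getLast?_cons_cons]; exact ha
      · intro a ha b hb
        rw [getLast?_concat] at ha
        simp at ha hb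
        subst ha hb
        exact h1.1

theorem inDeg_le_length {V : Type*} {A : V → V → Prop} {v : V} (L : List V)
    (h : ∀ x, A x v → x ∈ L) : inDeg A v ≤ L.length := by
  classical
  calc Nat.card {w // A w v} ≤ Nat.card {w // w ∈ L.toFinset} :=
        Nat.card_le_card_of_injective (fun w => ⟨w.1, by simpa using h w.1 w.2⟩)
          (fun a b hab => by simpa [Subtype.ext_iff] using hab)
    _ = L.toFinset.card := Nat.card_eq_finsetCard _
    _ ≤ L.length := toFinset_card_le L

theorem outDeg_le_length {V : Type*} {A : V → V → Prop} {v : V} (L : List V)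
    (h : ∀ x, A v x → x ∈ L) : outDeg A v ≤ L.length :=
  inDeg_le_length (A := fun x y => A y x) L h

theorem length_append_le_card {V : Type*} [Fintype V] {C P : List V} (hC : C.Nodup)
    (hP : P.Nodup) (hd : Disjoint C P) : C.length + P.length ≤ Fintype.card V := by
  rw [← length_append]
  exact (hC.append hP hd).length_le_card

theorem IsDicycle.cyclicSplit_append {V : Type*} {A : V → V → Prop} {C P Q R : List V}
    {S T : V → Bool} (hC : IsDicycle A C) (hP0 : P ≠ []) (hP : P.Nodup) (hPc : P.IsChain A)
    (hd : Disjoint C P) (hS : ∀ x, S x → ∀ y ∈ P.head?, A x y)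
    (hT : ∀ x, T x → ∀ y ∈ P.getLast?, A y x) (h : CyclicSplit S T C Q R) :
    IsDicycle A (P ++ R) := by
  obtain ⟨hr, ⟨a, ha, hSa⟩, ⟨b, hb, hTb⟩⟩ := h
  obtain ⟨-, hnd, hch⟩ := hC.isRotated hr.symm
  have hRC : ∀ x ∈ R, x ∈ C := fun x hx => hr.perm.mem_iff.1 (mem_append_right Q hx)
  rw [isDicycle_iff]
  refine ⟨by simp [hP0], ?_, ?_, ?_⟩
  · exact hP.append hnd.of_append_right fun x hx hx' => hd (hRC x hx') hx
  · rw [isChain_append]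
    refine ⟨hPc, hch.right_of_append.right_of_append, fun x hx y hy => ?_⟩
    have : y = b := by simp_all
    subst this
    exact hT y hTb x hx
  · intro x hx y hy
    have hx' : x = a := by rw [getLast?_append] at hx; simp_all
    have hy' : y ∈ P.head? := by
      cases P with
      | nil => simp at hP0
      | cons => simpa using hy
    subst hx'
    exact hS x hSa y hy'

/-- The data of a longest directed cycle together with a path in its complement that cannot be
extended at either end inside the complement. -/
structure MaxCyclePath {V : Type*} (A : V → V → Prop) (C P : List V) : Prop where
  isDicycle : IsDicycle A C
  length_le : ∀ C', IsDicycle A C' → C'.length ≤ C.length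
  ne_nil : P ≠ []
  nodup : P.Nodup
  isChain : P.IsChain A
  disjoint : Disjoint C P
  head_max : ∀ x, ∀ u ∈ P.head?, A x u → x ∈ C ∨ x ∈ P
  last_max : ∀ x, ∀ v ∈ P.getLast?, A v x → x ∈ C ∨ x ∈ P

open scoped Classical in
theorem MaxCyclePath.tight {V : Type*} [Fintype V] {A : V → V → Prop} (hirr : ∀ x, ¬ A x x)
    (hdeg : ∀ v, Fintype.card V ≤ 2 * outDeg A v + 1 ∧ Fintype.card V ≤ 2 * inDeg A v + 1)
    {C P : List V} (h : MaxCyclePath A C P) (hlen : Fintype.card V + 1 ≤ 2 * C.length)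
    {u v : V} (hu : u ∈ P.head?) (hv : v ∈ P.getLast?) :
    C.length + P.length = Fintype.card V ∧ 2 * inDeg A u < Fintype.card V ∧
    2 * outDeg A v < Fintype.card V ∧ (∀ x ∈ P, x ≠ u → A x u) ∧
    ∀ w ∈ C, ¬ A w u → ¬ A v w →
      ∃ Q R, CyclicSplit (fun x => decide (A x u)) (fun x => decide (A v x)) C Q R ∧
        w ∈ Q ∧ Q.length = P.length := by
  have hcard := length_append_le_card h.isDicycle.2.1 h.nodup h.disjoint
  obtain ⟨P₁, rfl⟩ : ∃ P₁, P = u :: P₁ := by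
    cases P with
    | nil => simp at hu
    | cons c R' => exact ⟨R', by simp_all⟩
  have hin : inDeg A u ≤ C.countP (fun x => decide (A x u)) +
      P₁.countP (fun x => decide (A x u)) := by
    rw [countP_eq_length_filter, countP_eq_length_filter, ← length_append]
    refine inDeg_le_length _ fun x hx => ?_
    rcases h.head_max x u hu hx with h' | h'
    · simp [h', hx]
    · rcases mem_cons.1 h' with rfl | h'
      · exact absurd hx (hirr x)
      · simp [h', hx]
  have hout : outDeg A v ≤ C.countP (fun x => decide (A v x)) + P₁.length := by
    have : P₁.length = (u :: P₁).dropLast.length := by simp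
    rw [countP_eq_length_filter, this, ← length_append]
    refine outDeg_le_length _ fun x hx => ?_
    rcases h.last_max x v hv hx with h' | h'
    · simp [h', hx]
    · rw [← dropLast_append_getLast? v hv, mem_append, mem_singleton] at h'
      rcases h' with h' | rfl
      · exact mem_append_right _ h'
      · exact absurd hx (hirr x)
  have hle : P₁.countP (fun x => decide (A x u)) ≤ P₁.length := countP_le_length
  have hdu := (hdeg u).2
  have hdv := (hdeg v).1
  have hPl : (u :: P₁).length = P₁.length + 1 := length_cons
  have hgap : ∀ Q R, CyclicSplit (fun x => decide (A x u)) (fun x => decide (A v x)) C Q R →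
      (u :: P₁).length ≤ Q.length := by
    intro Q R hQR
    have hc := h.isDicycle.cyclicSplit_append h.ne_nil h.nodup h.isChain h.disjoint
      (fun x hx y hy => by
        obtain rfl : u = y := by simp_all
        simpa using hx)
      (fun x hx y hy => by
        obtain rfl : v = y := by simp_all
        simpa using hx) hQR
    have h1 := h.length_le _ hc
    have h2 := hQR.1.perm.length_eq
    rw [length_append] at h1 h2
    omega
  have hex : ∃ Q R, CyclicSplit (fun x => decide (A x u)) (fun x => decide (A v x)) C Q R := by
    have hSpos : 0 < C.countP (fun x => decide (A x u)) := by omega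
    have hTpos : 0 < C.countP (fun x => decide (A v x)) := by omega
    obtain ⟨a, ha, hSa⟩ := countP_pos_iff.1 hSpos
    obtain ⟨b, hb, hTb⟩ := countP_pos_iff.1 hTpos
    exact exists_cyclicSplit ha hSa hb hTb
  obtain ⟨hb, heq⟩ := CyclicSplit.countP_add_countP_le (by omega) hgap hex
  refine ⟨by omega, by omega, by omega, ?_, fun w hw hS hT => ?_⟩
  · have : P₁.countP (fun x => decide (A x u)) = P₁.length := by omega
    rw [countP_eq_length] at this
    intro x hx hxu
    simpa using this x (by simp_all)
  · exact heq (by omega) w hw (by simpa using hS) (by simpa using hT)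

/-- Every vertex outside a longest cycle has small semi-degrees, if a path covers all of them. -/
theorem MaxCyclePath.deg_lt {V : Type*} [Fintype V] {A : V → V → Prop} (hirr : ∀ x, ¬ A x x)
    (hdeg : ∀ v, Fintype.card V ≤ 2 * outDeg A v + 1 ∧ Fintype.card V ≤ 2 * inDeg A v + 1)
    {C P : List V} (h : MaxCyclePath A C P) (hlen : Fintype.card V + 1 ≤ 2 * C.length)
    (hspan : ∀ x, x ∈ C ∨ x ∈ P) {x : V} (hx : x ∈ P) :
    2 * inDeg A x < Fintype.card V ∧ 2 * outDeg A x < Fintype.card V := by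
  have key : ∀ P', P ~r P' → MaxCyclePath A C P' := by
    rcases P with _ | ⟨u, P₁⟩
    · simp at hx
    have hcyc : P₁ ≠ [] → IsDicycle A (u :: P₁) := by
      intro h0
      rw [isDicycle_iff]
      refine ⟨h.ne_nil, h.nodup, h.isChain, fun v hv y hy => ?_⟩
      have ht := (h.tight hirr hdeg hlen (u := u) (by simp) hv).2.2.2.1
      obtain rfl : u = y := by simpa using hy
      refine ht v (mem_of_getLast? hv) ?_
      rintro rfl
      have hv' : v ∈ P₁ := by
        rcases P₁ with _ | ⟨y, P₁⟩
        · exact absurd rfl h0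
        · rw [getLast?_cons_cons] at hv
          exact mem_of_getLast? hv
      exact (nodup_cons.1 h.nodup).1 hv'
    intro P' hr
    by_cases h0 : P₁ = []
    · subst h0
      rw [isRotated_singleton_iff'] at hr
      exact hr ▸ h
    · have hP' := (hcyc h0).isRotated hr
      have hsp : ∀ x, x ∈ C ∨ x ∈ P' := fun x => by rw [← hr.perm.mem_iff]; exact hspan x
      exact ⟨h.isDicycle, h.length_le, hP'.1, hP'.2.1, hP'.2.2.left_of_append,
        fun y hy hy' => h.disjoint hy (hr.perm.mem_iff.2 hy'),
        fun y _ _ _ => hsp y, fun y _ _ _ => hsp y⟩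
  obtain ⟨P₁, P₂, rfl⟩ := append_of_mem hx
  constructor
  · have h1 := key (x :: P₂ ++ P₁) isRotated_append
    obtain ⟨v, hv⟩ : ∃ v, v ∈ (x :: P₂ ++ P₁).getLast? :=
      ⟨_, getLast?_eq_getLast_of_ne_nil (by simp)⟩
    exact (h1.tight hirr hdeg hlen (u := x) (by simp) hv).2.1
  · have h1 := key (P₂ ++ P₁ ++ [x]) (by
      have := isRotated_append (l := P₁ ++ [x]) (l' := P₂)
      simpa using this)
    obtain ⟨u, hu⟩ : ∃ u, u ∈ (P₂ ++ P₁ ++ [x]).head? := by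
      rcases h : P₂ ++ P₁ ++ [x] with _ | ⟨u, L⟩
      · simp at h
      · exact ⟨u, by simp⟩
    exact (h1.tight hirr hdeg hlen hu (v := x) getLast?_concat).2.2.1

theorem exists_length_maximal {V : Type*} [Fintype V] (p : List V → Prop)
    (hp : ∀ l, p l → l.Nodup) (hex : ∃ l, p l) :
    ∃ l, p l ∧ ∀ l', p l' → l'.length ≤ l.length := by
  classical
  have hfin : {l | p l}.Finite :=
    (List.finite_length_le V (Fintype.card V)).subset fun l hl => (hp l hl).length_le_card
  obtain ⟨l, hl, hmax⟩ := hfin.exists_maximalFor length _ hex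
  exact ⟨l, hl, fun l' hl' => by
    by_contra! hlt
    have := hmax hl' hlt.le
    omega⟩

theorem exists_long_dicycle {V : Type*} [Fintype V] {A : V → V → Prop} (hirr : ∀ x, ¬ A x x)
    {d : ℕ} (hd : 0 < d) (w : V) (hdeg : ∀ v, d ≤ outDeg A v) :
    ∃ C, IsDicycle A C ∧ d + 1 ≤ C.length := by
  obtain ⟨L, ⟨hLn, hLc, hL0⟩, hmax⟩ := exists_length_maximal
    (fun l : List V => l.Nodup ∧ l.IsChain A ∧ l ≠ []) (fun l h => h.1) ⟨[w], by simp⟩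
  rcases eq_nil_or_concat L with rfl | ⟨M, v, rfl⟩
  · simp at hL0
  rw [concat_eq_append] at *
  have hM : ∀ x, A v x → x ∈ M := by
    intro x hx
    by_contra hxM
    have hxv : x ≠ v := by rintro rfl; exact hirr x hx
    have := hmax (M ++ [v] ++ [x]) ⟨?_, ?_, by simp⟩
    · simp at this
    · rw [nodup_append_comm, singleton_append, nodup_cons]
      exact ⟨by simp [hxM, hxv], hLn⟩
    · rw [isChain_append]
      refine ⟨hLc, by simp, ?_⟩
      intro a ha b hb
      rw [getLast?_concat] at ha
      simp at ha hb
      subst ha hb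
      exact hx
  have : ∀ K N : List V, K ++ N = M → (∀ x, A v x → x ∈ N) →
      ∃ K' N' y, K' ++ y :: N' = M ∧ A v y ∧ ∀ x, A v x → x ∈ y :: N' := by
    intro K N
    induction N generalizing K with
    | nil =>
      intro _ h
      have := outDeg_le_length [] h
      have := hdeg v
      simp at *
      omega
    | cons y N ih =>
      intro hK h
      by_cases hy : A v y
      · exact ⟨K, N, y, hK, hy, h⟩
      · refine ih (K ++ [y]) (by simpa using hK) fun x hx => ?_
        rcases mem_cons.1 (h x hx) with rfl | h'
        · exact absurd hx hy
        · exact h'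
  obtain ⟨K, N, y, rfl, hy, hN⟩ := this [] M rfl hM
  refine ⟨y :: N ++ [v], isDicycle_iff.2 ⟨by simp, ?_, ?_, ?_⟩, ?_⟩
  · rw [append_assoc] at hLn
    exact hLn.of_append_right
  · rw [append_assoc] at hLc
    exact hLc.right_of_append
  · intro a ha b hb
    rw [getLast?_concat] at ha
    simp at ha hb
    subst ha hb
    exact hy
  · have := outDeg_le_length _ hN
    have := hdeg v
    simp at *
    omega

/-- A variant of the Ghouila-Houri theorem: all semi-degrees may be one half below the usual bound
provided that this bound holds for the in-degrees of some vertex `w` and of its out-neighbours, and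
for the out-degrees of its in-neighbours. -/
theorem exists_hamiltonian_dicycle {V : Type*} [Fintype V] {A : V → V → Prop}
    (hirr : ∀ x, ¬ A x x)
    (hdeg : ∀ v, Fintype.card V ≤ 2 * outDeg A v + 1 ∧ Fintype.card V ≤ 2 * inDeg A v + 1)
    (hcard : 2 ≤ Fintype.card V) (w : V)
    (hwi : Fintype.card V ≤ 2 * inDeg A w)
    (hto : ∀ v, A v w → Fintype.card V ≤ 2 * outDeg A v)
    (hfrom : ∀ v, A w v → Fintype.card V ≤ 2 * inDeg A v) :
    ∃ C, IsDicycle A C ∧ ∀ x, x ∈ C := by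
  classical
  obtain ⟨C₀, hC₀, hC₀l⟩ := exists_long_dicycle hirr (d := Fintype.card V / 2) (by omega) w
    (fun v => by have := (hdeg v).1; omega)
  obtain ⟨C, hC, hmax⟩ := exists_length_maximal (IsDicycle A) (fun l h => h.2.1) ⟨C₀, hC₀⟩
  have hlen : Fintype.card V + 1 ≤ 2 * C.length := by have := hmax _ hC₀; omega
  refine ⟨C, hC, ?_⟩
  by_contra! ⟨z, hz⟩
  obtain ⟨P, ⟨hPn, hPc, hP0, hPd⟩, hPmax⟩ := exists_length_maximal
    (fun l : List V => l.Nodup ∧ l.IsChain A ∧ l ≠ [] ∧ Disjoint C l) (fun l h => h.1)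
    ⟨[z], by simpa using hz⟩
  have hCP : MaxCyclePath A C P := by
    refine ⟨hC, hmax, hP0, hPn, hPc, hPd, fun x u hu hx => ?_, fun x v hv hx => ?_⟩
    · by_contra! ⟨hxC, hxP⟩
      have := hPmax (x :: P) ⟨nodup_cons.2 ⟨hxP, hPn⟩, ?_, by simp, ?_⟩
      · simp at this
      · rw [isChain_cons]
        refine ⟨fun y hy => ?_, hPc⟩
        obtain rfl : u = y := by simp_all
        exact hx
      · simp [hxC, hPd]
    · by_contra! ⟨hxC, hxP⟩
      have := hPmax (P ++ [x]) ⟨?_, ?_, by simp, ?_⟩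
      · simp at this
      · rw [nodup_append_comm, singleton_append]
        exact nodup_cons.2 ⟨hxP, hPn⟩
      · rw [isChain_append]
        refine ⟨hPc, by simp, fun a ha b hb => ?_⟩
        obtain rfl : v = a := by simp_all
        obtain rfl : x = b := by simpa using hb
        exact hx
      · simp [hxC, hPd]
  obtain ⟨u, hu⟩ : ∃ u, u ∈ P.head? := ⟨_, head?_eq_some_head hP0⟩
  obtain ⟨v, hv⟩ : ∃ v, v ∈ P.getLast? := ⟨_, getLast?_eq_getLast_of_ne_nil hP0⟩
  obtain ⟨hsum, hdu, hdv, -, hQR⟩ := hCP.tight hirr hdeg hlen hu hv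
  have hall : ∀ {C P : List V}, C.Nodup → P.Nodup → Disjoint C P →
      C.length + P.length = Fintype.card V → ∀ x, x ∈ C ∨ x ∈ P := by
    intro C P h1 h2 h3 h4 x
    have hnd := h1.append h2 h3
    have : (C ++ P).toFinset = Finset.univ := by
      rw [← Finset.card_eq_iff_eq_univ, toFinset_card_of_nodup hnd, length_append, h4]
    rw [← mem_append, ← mem_toFinset, this]
    exact Finset.mem_univ x
  have hspan := hall hC.2.1 hPn hPd hsum
  have hwP : w ∉ P := fun hw => by
    have := (hCP.deg_lt hirr hdeg hlen hspan hw).1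
    omega
  have hwC : w ∈ C := (hspan w).resolve_right hwP
  obtain ⟨Q, R, hs, hwQ, hQl⟩ := hQR w hwC
    (fun h => by have := hfrom u h; omega) (fun h => by have := hto v h; omega)
  have hcyc : IsDicycle A (P ++ R) := by
    refine hC.cyclicSplit_append hP0 hPn hPc hPd (fun x hx y hy => ?_) (fun x hx y hy => ?_) hs
    · obtain rfl : u = y := by simp_all
      simpa using hx
    · obtain rfl : v = y := by simp_all
      simpa using hx
  have hl : (P ++ R).length = C.length := by
    rw [← hs.1.perm.length_eq, length_append, length_append, hQl]
  obtain ⟨-, hQRn, hQRc⟩ := hC.isRotated hs.1.symm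
  have hd : Disjoint (P ++ R) Q := by
    intro x hx hxQ
    rcases mem_append.1 hx with hx | hx
    · exact hPd (hs.1.perm.mem_iff.1 (mem_append_left R hxQ)) hx
    · exact disjoint_of_nodup_append hQRn hxQ hx
  have hspan' := hall hcyc.2.1 hQRn.of_append_left hd (by omega)
  have hM : MaxCyclePath A (P ++ R) Q :=
    ⟨hcyc, fun C' h => hl ▸ hmax C' h, ne_nil_of_mem hwQ, hQRn.of_append_left,
      hQRc.left_of_append.left_of_append, hd, fun x _ _ _ => hspan' x, fun x _ _ _ => hspan' x⟩
  have := (hM.deg_lt hirr hdeg (by omega) hspan' hwQ).1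
  omega

/-- The digraph obtained by replacing `s` and `t` by `k` pairwise non-adjacent vertices, each with
the out-neighbours of `s` and the in-neighbours of `t`. -/
def splice {V : Type*} (A : V → V → Prop) (s t : V) (k : ℕ) :
    {v : V // v ≠ s ∧ v ≠ t} ⊕ Fin k → {v : V // v ≠ s ∧ v ≠ t} ⊕ Fin k → Prop
  | .inl a, .inl b => A a b
  | .inl a, .inr _ => A a t
  | .inr _, .inl b => A s b
  | .inr _, .inr _ => False

theorem exists_pieces_of_isChain_splice {V : Type*} {A : V → V → Prop} {s t : V} {k : ℕ}
    (j : Fin k) (L : List ({v : V // v ≠ s ∧ v ≠ t} ⊕ Fin k))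
    (x : {v : V // v ≠ s ∧ v ≠ t} ⊕ Fin k)
    (h : (x :: L ++ [Sum.inr j]).IsChain (splice A s t k)) :
    ∃ (p : List V) (ps : List (List V)),
      (Sum.elim Subtype.val (fun _ => s) x :: p ++ [t]).IsChain A ∧
      (∀ q ∈ ps, (s :: q ++ [t]).IsChain A) ∧
      ps.length = (L.filterMap Sum.getRight?).length ∧
      (p :: ps).flatten = (L.filterMap Sum.getLeft?).map Subtype.val := by
  induction L generalizing x with
  | nil =>
    refine ⟨[], [], ?_, by simp, by simp, by simp⟩
    rcases x with a | i
    · simpa [splice] using h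
    · simp [splice] at h
  | cons y L ih =>
    rw [cons_append, cons_append, isChain_cons_cons] at h
    obtain ⟨p, ps, h1, h2, h3, h4⟩ := ih y h.2
    rcases y with b | i
    · refine ⟨b.1 :: p, ps, ?_, h2, ?_, ?_⟩
      rotate_left
      · rw [filterMap_cons_none rfl, h3]
      · rw [filterMap_cons_some (f := Sum.getLeft?) (a := .inl b) (b := b) rfl, map_cons, ← h4, flatten_cons,
          flatten_cons, cons_append]
      rw [cons_append, cons_append, isChain_cons_cons]
      refine ⟨?_, by simpa using h1⟩
      rcases x with a | i <;> simpa [splice] using h.1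
    · refine ⟨[], p :: ps, ?_, ?_, ?_, ?_⟩
      · rcases x with a | i
        · simpa [splice] using h.1
        · exact h.1.elim
      · simp only [mem_cons, forall_eq_or_imp]
        exact ⟨by simpa using h1, h2⟩
      · rw [filterMap_cons_some (f := Sum.getRight?) (a := .inr i) (b := i) rfl, length_cons, length_cons, h3]
      · rw [filterMap_cons_none rfl, ← h4, flatten_cons, nil_append]

theorem exists_pieces_of_hamiltonian_splice {V : Type*} {A : V → V → Prop} {s t : V} {k : ℕ}
    (hk : 0 < k) {C : List ({v : V // v ≠ s ∧ v ≠ t} ⊕ Fin k)}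
    (hC : IsDicycle (splice A s t k) C) (hall : ∀ x, x ∈ C) :
    ∃ ps : List (List V), ps.length = k ∧ (∀ q ∈ ps, (s :: q ++ [t]).IsChain A) ∧
      ps.flatten.Nodup ∧ ∀ v, v ∈ ps.flatten ↔ v ≠ s ∧ v ≠ t := by
  obtain ⟨C₁, C₂, rfl⟩ := append_of_mem (hall (.inr ⟨0, hk⟩))
  have hr : (C₁ ++ .inr ⟨0, hk⟩ :: C₂) ~r (.inr ⟨0, hk⟩ :: (C₂ ++ C₁)) := by
    simpa using isRotated_append (l := C₁) (l' := .inr ⟨0, hk⟩ :: C₂)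
  obtain ⟨-, hnd, hch⟩ := hC.isRotated hr
  have hall' := fun x => hr.perm.mem_iff.1 (hall x)
  generalize C₂ ++ C₁ = L at *
  obtain ⟨p, ps, h1, h2, h3, h4⟩ := exists_pieces_of_isChain_splice ⟨0, hk⟩ L (.inr ⟨0, hk⟩)
    (by
      have : Sum.inr ⟨0, hk⟩ :: L ++ Sum.inr ⟨0, hk⟩ :: L =
        (Sum.inr ⟨0, hk⟩ :: L ++ [Sum.inr ⟨0, hk⟩]) ++ L := by simp
      rw [this] at hch
      exact hch.left_of_append)
  refine ⟨p :: ps, ?_, ?_, ?_, ?_⟩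
  · have hn : ((Sum.inr ⟨0, hk⟩ :: L).filterMap Sum.getRight?).Nodup :=
      hnd.filterMap (by rintro (a | a) (b | b) c <;> simp; rintro rfl rfl; rfl)
    have hl : ((Sum.inr ⟨0, hk⟩ :: L).filterMap Sum.getRight?).length = k := by
      rw [← toFinset_card_of_nodup hn]
      have : ((Sum.inr ⟨0, hk⟩ :: L).filterMap Sum.getRight?).toFinset = Finset.univ := by
        ext i
        simp only [mem_toFinset, mem_filterMap, Finset.mem_univ, iff_true]
        exact ⟨.inr i, hall' _, rfl⟩
      rw [this, Finset.card_univ, Fintype.card_fin]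
    simpa [h3] using hl
  · simp only [mem_cons, forall_eq_or_imp]
    exact ⟨by simpa using h1, h2⟩
  · rw [h4]
    refine Nodup.map Subtype.val_injective ?_
    exact (nodup_cons.1 hnd).2.filterMap
      (by rintro (a | a) (b | b) c <;> simp; rintro rfl rfl; rfl)
  · intro v
    rw [h4]
    simp only [mem_map, mem_filterMap]
    constructor
    · rintro ⟨a, -, rfl⟩
      exact a.2
    · intro hv
      refine ⟨⟨v, hv⟩, ⟨.inl ⟨v, hv⟩, ?_, rfl⟩, rfl⟩
      simpa using hall' (.inl ⟨v, hv⟩)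

theorem exists_paths_of_pieces {V : Type*} {A : V → V → Prop} {s t : V} (hst : s ≠ t)
    {k : ℕ} (hk : 0 < k) (ps : List (List V)) (hl : ps.length = k)
    (hc : ∀ q ∈ ps, (s :: q ++ [t]).IsChain A) (hn : ps.flatten.Nodup)
    (hm : ∀ v, v ∈ ps.flatten ↔ v ≠ s ∧ v ≠ t) :
    ∃ P : Fin k → List V,
      (∀ i, IsDipath A (P i) s t) ∧
      (∀ i j, i ≠ j → ∀ v, v ∈ P i → v ∈ P j → v = s ∨ v = t) ∧
      (∀ v : V, ∃ i, v ∈ P i) := by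
  subst hl
  rw [nodup_flatten] at hn
  obtain ⟨hn1, hn2⟩ := hn
  refine ⟨fun i => s :: ps.get i ++ [t], fun i => ⟨by simp, hc _ (get_mem ps i), ?_, by simp,
    getLast?_concat⟩, ?_, ?_⟩
  · have hq : ∀ v ∈ ps.get i, v ≠ s ∧ v ≠ t := fun v hv =>
      (hm v).1 (mem_flatten.2 ⟨_, get_mem ps i, hv⟩)
    simp only [cons_append]
    rw [nodup_cons, nodup_append_comm, singleton_append, nodup_cons]
    refine ⟨?_, fun h => (hq t h).2 rfl, hn1 _ (get_mem ps i)⟩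
    simp only [mem_append, mem_singleton, not_or]
    exact ⟨fun h => (hq s h).1 rfl, hst⟩
  · intro i j hij v hi hj
    have hdis : ∀ i j : Fin ps.length, i < j → v ∈ ps.get i → v ∈ ps.get j → False :=
      fun i j hlt h1 h2 => pairwise_iff_get.1 hn2 i j hlt h1 h2
    simp only [cons_append, mem_cons, mem_append, not_mem_nil, or_false] at hi hj
    by_contra! hv
    have hi' : v ∈ ps.get i := by tauto
    have hj' : v ∈ ps.get j := by tauto
    rcases lt_or_gt_of_ne hij with h | h
    · exact hdis i j h hi' hj'
    · exact hdis j i h hj' hi'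
  · intro v
    by_cases hv : v ≠ s ∧ v ≠ t
    · obtain ⟨q, hq, hvq⟩ := mem_flatten.1 ((hm v).2 hv)
      obtain ⟨i, rfl⟩ := get_of_mem hq
      exact ⟨i, by simp_all⟩
    · refine ⟨⟨0, hk⟩, ?_⟩
      simp only [cons_append, mem_cons, mem_append, not_mem_nil, or_false]
      tauto

theorem card_subtype_le_succ {V : Type*} [Fintype V] (p : V → Prop) (a : V) :
    Nat.card {x // p x} ≤ Nat.card {x // p x ∧ x ≠ a} + 1 := by
  classical
  rw [Nat.subtype_card (Finset.univ.filter p) (by simp),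
    Nat.subtype_card ((Finset.univ.filter p).erase a) (by simp [and_comm])]
  have := Finset.pred_card_le_card_erase (s := Finset.univ.filter p) (a := a)
  omega

theorem card_subtype_le_of_injOn {V W : Type*} [Finite W] {p : V → Prop} {q : W → Prop}
    (f : V → W) (hf : Set.InjOn f {x | p x}) (h : ∀ x, p x → q (f x)) :
    Nat.card {x // p x} ≤ Nat.card {x // q x} :=
  Nat.card_le_card_of_injective (fun x : {x // p x} => (⟨f x.1, h x.1 x.2⟩ : {x // q x}))
    fun a b hab => Subtype.ext (hf a.2 b.2 (congrArg Subtype.val hab))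

open scoped Classical in
/-- The embedding of all vertices into the spliced digraph, with given images of `s` and `t`. -/
noncomputable def spliceMap {V : Type*} (s t : V) {k : ℕ} (i j : Fin k) (x : V) :
    {v : V // v ≠ s ∧ v ≠ t} ⊕ Fin k :=
  if h : x ≠ s ∧ x ≠ t then .inl ⟨x, h⟩ else if x = s then .inr i else .inr j

theorem spliceMap_of_ne {V : Type*} {s t x : V} {k : ℕ} (i j : Fin k) (h : x ≠ s ∧ x ≠ t) :
    spliceMap s t i j x = .inl ⟨x, h⟩ := by simp [spliceMap, h]

theorem spliceMap_left {V : Type*} (s t : V) {k : ℕ} (i j : Fin k) :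
    spliceMap s t i j s = .inr i := by simp [spliceMap]

theorem spliceMap_right {V : Type*} {s t : V} (hst : s ≠ t) {k : ℕ} (i j : Fin k) :
    spliceMap s t i j t = .inr j := by simp [spliceMap, hst.symm]

theorem spliceMap_injOn {V : Type*} {s t : V} {k : ℕ} (i j : Fin k) {X : Set V}
    (hX : s ∈ X → t ∈ X → i ≠ j) : Set.InjOn (spliceMap s t i j) X := by
  intro x hx y hy hxy
  by_cases h1 : x ≠ s ∧ x ≠ t <;> by_cases h2 : y ≠ s ∧ y ≠ t
  · rw [spliceMap_of_ne _ _ h1, spliceMap_of_ne _ _ h2] at hxy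
    simpa using hxy
  all_goals
    by_cases hxs : x = s <;> by_cases hys : y = s <;> simp_all [spliceMap]

theorem splice_deg {V : Type*} [Fintype V] {A : V → V → Prop} (hirr : ∀ x, ¬ A x x) {s t : V}
    (hst : s ≠ t) {k : ℕ} (hk : 0 < k) (x : {v : V // v ≠ s ∧ v ≠ t} ⊕ Fin k) {d : ℕ}
    (hd : ∀ v, d ≤ outDeg A v ∧ d ≤ inDeg A v) :
    d ≤ outDeg (splice A s t k) x + 1 ∧ d ≤ inDeg (splice A s t k) x + 1 := by
  have hz : Fin k := ⟨0, hk⟩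
  rcases x with a | i
  · refine ⟨(hd a).1.trans ((card_subtype_le_succ _ s).trans (Nat.add_le_add_right
      (card_subtype_le_of_injOn (spliceMap s t hz hz) (spliceMap_injOn _ _ ?_) ?_) 1)),
      (hd a).2.trans ((card_subtype_le_succ _ t).trans (Nat.add_le_add_right
      (card_subtype_le_of_injOn (spliceMap s t hz hz) (spliceMap_injOn _ _ ?_) ?_) 1))⟩
    · rintro ⟨-, h⟩; exact absurd rfl h
    · rintro y ⟨h1, h2⟩
      by_cases hy : y = t
      · subst hy; rw [spliceMap_right hst]; exact h1
      · rw [spliceMap_of_ne _ _ ⟨h2, hy⟩]; exact h1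
    · rintro - ⟨-, h⟩; exact absurd rfl h
    · rintro y ⟨h1, h2⟩
      by_cases hy : y = s
      · subst hy; rw [spliceMap_left]; exact h1
      · rw [spliceMap_of_ne _ _ ⟨hy, h2⟩]; exact h1
  · refine ⟨(hd s).1.trans ((card_subtype_le_succ _ t).trans (Nat.add_le_add_right
      (card_subtype_le_of_injOn (spliceMap s t hz hz) (spliceMap_injOn _ _ ?_) ?_) 1)),
      (hd t).2.trans ((card_subtype_le_succ _ s).trans (Nat.add_le_add_right
      (card_subtype_le_of_injOn (spliceMap s t hz hz) (spliceMap_injOn _ _ ?_) ?_) 1))⟩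
    · rintro - ⟨-, h⟩; exact absurd rfl h
    · rintro y ⟨h1, h2⟩
      have hy : y ≠ s := by rintro rfl; exact hirr _ h1
      rw [spliceMap_of_ne _ _ ⟨hy, h2⟩]; exact h1
    · rintro ⟨-, h⟩; exact absurd rfl h
    · rintro y ⟨h1, h2⟩
      have hy : y ≠ t := by rintro rfl; exact hirr _ h1
      rw [spliceMap_of_ne _ _ ⟨h2, hy⟩]; exact h1

theorem splice_deg_of_not_adj {V : Type*} [Fintype V] {A : V → V → Prop} (hirr : ∀ x, ¬ A x x)
    {s t : V} (hst : s ≠ t) (hA : ¬ A s t) {k : ℕ} (hk : 2 ≤ k) {d : ℕ}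
    (hd : ∀ v, d ≤ outDeg A v ∧ d ≤ inDeg A v) (i : Fin k) :
    d ≤ inDeg (splice A s t k) (.inr i) ∧
    (∀ x, splice A s t k x (.inr i) → d ≤ outDeg (splice A s t k) x) ∧
    (∀ x, splice A s t k (.inr i) x → d ≤ inDeg (splice A s t k) x) := by
  have h01 : (⟨0, by omega⟩ : Fin k) ≠ ⟨1, by omega⟩ := by simp
  generalize (⟨0, by omega⟩ : Fin k) = z at h01
  generalize (⟨1, by omega⟩ : Fin k) = o at h01
  refine ⟨(hd t).2.trans (card_subtype_le_of_injOn (spliceMap s t z o)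
    (spliceMap_injOn _ _ fun _ _ => h01) fun y hy => ?_), ?_, ?_⟩
  · have h1 : y ≠ s := by rintro rfl; exact hA hy
    have h2 : y ≠ t := by rintro rfl; exact hirr _ hy
    rw [spliceMap_of_ne _ _ ⟨h1, h2⟩]; exact hy
  · rintro (a | j) hx
    · refine (hd a).1.trans (card_subtype_le_of_injOn (spliceMap s t z o)
        (spliceMap_injOn _ _ fun _ _ => h01) fun y hy => ?_)
      by_cases h : y ≠ s ∧ y ≠ t
      · rw [spliceMap_of_ne _ _ h]; exact hy
      · by_cases hs : y = s
        · subst hs; rw [spliceMap_left]; exact hx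
        · obtain rfl : y = t := by tauto
          rw [spliceMap_right hst]; exact hx
    · exact hx.elim
  · rintro (a | j) hx
    · refine (hd a).2.trans (card_subtype_le_of_injOn (spliceMap s t z o)
        (spliceMap_injOn _ _ fun _ _ => h01) fun y hy => ?_)
      by_cases h : y ≠ s ∧ y ≠ t
      · rw [spliceMap_of_ne _ _ h]; exact hy
      · by_cases hs : y = s
        · subst hs; rw [spliceMap_left]; exact hx
        · obtain rfl : y = t := by tauto
          rw [spliceMap_right hst]; exact hx
    · exact hx.elim

theorem splice_irrefl {V : Type*} {A : V → V → Prop} (hirr : ∀ x, ¬ A x x) (s t : V) (k : ℕ)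
    (x : {v : V // v ≠ s ∧ v ≠ t} ⊕ Fin k) : ¬ splice A s t k x x := by
  rcases x with a | i
  · exact hirr a
  · exact id

theorem card_splice {V : Type*} [Fintype V] {s t : V} (hst : s ≠ t) (k : ℕ)
    [Fintype {v : V // v ≠ s ∧ v ≠ t}] :
    Fintype.card ({v : V // v ≠ s ∧ v ≠ t} ⊕ Fin k) + 2 = Fintype.card V + k := by
  classical
  have h : Fintype.card {v : V // v ≠ s ∧ v ≠ t} + 2 = Fintype.card V := by
    rw [Fintype.card_of_subtype ({s, t}ᶜ : Finset V) (by simp), Finset.card_compl,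
      Finset.card_pair hst]
    have := Finset.card_le_univ ({s, t} : Finset V)
    rw [Finset.card_pair hst] at this
    omega
  rw [Fintype.card_sum, Fintype.card_fin]
  omega

end

/-- Let `D` be a digraph of order `n ≥ k + 1`, `k ≥ 2`. If
`δ⁰(D) ≥ ⌈(n+k-1)/2⌉`, then `D` is one-to-one `k`-coverable. -/
theorem one_to_one_of_min_semi_degree {V : Type*} [Fintype V]
    (A : V → V → Prop) (hirr : Irreflexive A) (k : ℕ) (hk : 2 ≤ k)
    (hn : k + 1 ≤ Fintype.card V)
    (hdeg : ∀ v : V, (Fintype.card V + k) / 2 ≤ outDeg A v ∧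
      (Fintype.card V + k) / 2 ≤ inDeg A v) :
    OneToOneCoverable A k := by
  classical
  intro s t hst
  set d := (Fintype.card V + k) / 2 with hd
  by_cases hA : A s t
  · have hcard := card_splice hst (k - 1)
    have hdeg' := fun x => splice_deg hirr hst (k := k - 1) (by omega) x hdeg
    obtain ⟨C, hC, hall⟩ := exists_hamiltonian_dicycle (splice_irrefl hirr s t (k - 1))
      (fun x => by have := hdeg' x; omega) (by omega) (.inr ⟨0, by omega⟩)
      (by have := hdeg' (.inr ⟨0, by omega⟩); omega)
      (fun x _ => by have := hdeg' x; omega) (fun x _ => by have := hdeg' x; omega)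
    obtain ⟨ps, h1, h2, h3, h4⟩ := exists_pieces_of_hamiltonian_splice (by omega) hC hall
    refine exists_paths_of_pieces hst (by omega) ([] :: ps) (by simp; omega) ?_ (by simpa using h3)
      (by simpa using h4)
    simp only [List.mem_cons, forall_eq_or_imp]
    exact ⟨by simpa using hA, h2⟩
  · have hcard := card_splice hst k
    have hdeg' := fun x => splice_deg hirr hst (k := k) (by omega) x hdeg
    obtain ⟨hw, hto, hfrom⟩ := splice_deg_of_not_adj hirr hst hA hk hdeg ⟨0, by omega⟩
    obtain ⟨C, hC, hall⟩ := exists_hamiltonian_dicycle (splice_irrefl hirr s t k)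
      (fun x => by have := hdeg' x; omega) (by omega) (.inr ⟨0, by omega⟩) (by omega)
      (fun x hx => by have := hto x hx; omega) (fun x hx => by have := hfrom x hx; omega)
    obtain ⟨ps, h1, h2, h3, h4⟩ := exists_pieces_of_hamiltonian_splice (by omega) hC hall
    exact exists_paths_of_pieces hst (by omega) ps h1 h2 h3 h4
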